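/- Let d ≥ 1 and let r ≥ 1 be a real number. Let h_n, h : [0,1]^d → [0,1] for n ∈ ℕ, let G : [0,1]^d → ℝ, and let (c_n) be positive reals with c_n → ∞. Assume sup_{u ∈ [0,1]^d} |c_n (h_n(u) − h(u)) − G(u)| → 0 and that h satisfies h(u) = (h(u^{1/r}))^r for all u ∈ [0,1]^d. Then sup_{u ∈ [0,1]^d} |c_n ((h_n(u^{1/r}))^r − h_n(u)) − [ r (h(u^{1/r}))^{r−1} G(u^{1/r}) − G(u) ]| → 0 as n → ∞ (a deterministic analogue of the limit of the test process D_{r,n}(u) = √n [(C_n(u^{1/r}))^r − C_n(u)] under the hypothesis H_{0,r}). -/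

import Mathlib

/-- Mean value theorem for `x ↦ x ^ r` with a point `ξ` allowing for `a = b`. -/
theorem exists_rpow_sub_rpow_eq {r : ℝ} (hr : 1 ≤ r) (a b : ℝ) :
    ∃ ξ ∈ Set.uIcc a b, a ^ r - b ^ r = r * ξ ^ (r - 1) * (a - b) := by
  have hder (x : ℝ) : HasDerivAt (fun y : ℝ => y ^ r) (r * x ^ (r - 1)) x :=
    Real.hasDerivAt_rpow_const (Or.inr hr)
  have hcont : Continuous fun y : ℝ => y ^ r :=
    continuous_iff_continuousAt.2 fun x => (hder x).continuousAt
  rcases lt_trichotomy a b with hab | rfl | hab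
  · obtain ⟨ξ, hξ, he⟩ := exists_hasDerivAt_eq_slope _ _ hab hcont.continuousOn
      fun x _ => hder x
    refine ⟨ξ, Set.Icc_subset_uIcc (Set.Ioo_subset_Icc_self hξ), ?_⟩
    have : b - a ≠ 0 := sub_ne_zero.2 hab.ne'
    rw [he]
    field_simp
    ring
  · exact ⟨a, Set.left_mem_uIcc, by simp⟩
  · obtain ⟨ξ, hξ, he⟩ := exists_hasDerivAt_eq_slope _ _ hab hcont.continuousOn
      fun x _ => hder x
    refine ⟨ξ, Set.Icc_subset_uIcc' (Set.Ioo_subset_Icc_self hξ), ?_⟩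
    have : a - b ≠ 0 := sub_ne_zero.2 hab.ne'
    rw [he]
    field_simp

/-- Uniform delta method for `x ↦ x ^ r` on `[0, 1]`. -/
theorem exists_forall_abs_mul_rpow_sub_rpow_sub_lt {r : ℝ} (hr : 1 ≤ r) {M : ℝ} (hM : 0 < M)
    {ε : ℝ} (hε : 0 < ε) :
    ∃ C : ℝ, ∃ η > 0, ∀ c a b g : ℝ, 0 < c → C ≤ c → a ∈ Set.Icc (0 : ℝ) 1 →
      b ∈ Set.Icc (0 : ℝ) 1 → |g| ≤ M → |c * (a - b) - g| < η →
      |c * (a ^ r - b ^ r) - r * b ^ (r - 1) * g| < ε := by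
  have hr0 : 0 < r := by linarith
  have huc : UniformContinuousOn (fun x : ℝ => x ^ (r - 1)) (Set.Icc 0 1) :=
    isCompact_Icc.uniformContinuousOn_of_continuous
      (Real.continuous_rpow_const (by linarith)).continuousOn
  obtain ⟨δ, hδ, huc⟩ := Metric.uniformContinuousOn_iff.1 huc (ε / (2 * r * M)) (by positivity)
  refine ⟨(M + 2) / δ, min (ε / (2 * r)) 1, by positivity, fun c a b g hc hCc ha hb hg hη => ?_⟩
  obtain ⟨hη₁, hη₂⟩ := lt_min_iff.1 hη
  obtain ⟨ξ, hξ, he⟩ := exists_rpow_sub_rpow_eq hr a b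
  have hξ' : ξ ∈ Set.Icc (0 : ℝ) 1 := Set.uIcc_subset_Icc ha hb hξ
  have hab : |a - b| < δ := by
    have h₁ : c * |a - b| < M + 2 := by
      calc c * |a - b| = |(c * (a - b) - g) + g| := by
            rw [sub_add_cancel, abs_mul, abs_of_pos hc]
        _ ≤ |c * (a - b) - g| + |g| := abs_add_le _ _
        _ < M + 2 := by linarith
    rw [div_le_iff₀ hδ] at hCc
    exact lt_of_mul_lt_mul_left (h₁.trans_le hCc) hc.le
  have hξb : |ξ - b| < δ := by
    refine lt_of_le_of_lt ?_ hab
    have := Set.abs_sub_right_of_mem_uIcc hξ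
    rw [abs_sub_comm b ξ, abs_sub_comm b a] at this
    exact this
  have hd : |ξ ^ (r - 1) - b ^ (r - 1)| < ε / (2 * r * M) := huc ξ hξ' b hb hξb
  have hξ0 : 0 ≤ ξ ^ (r - 1) := Real.rpow_nonneg hξ'.1 _
  have hξ1 : ξ ^ (r - 1) ≤ 1 := Real.rpow_le_one hξ'.1 hξ'.2 (by linarith)
  have hsplit : c * (a ^ r - b ^ r) - r * b ^ (r - 1) * g =
      r * (ξ ^ (r - 1) * (c * (a - b) - g)) + r * ((ξ ^ (r - 1) - b ^ (r - 1)) * g) := by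
    rw [he]; ring
  calc |c * (a ^ r - b ^ r) - r * b ^ (r - 1) * g|
      ≤ r * (ξ ^ (r - 1) * |c * (a - b) - g|) + r * (|ξ ^ (r - 1) - b ^ (r - 1)| * |g|) := by
        rw [hsplit]
        refine (abs_add_le _ _).trans_eq ?_
        rw [abs_mul, abs_mul, abs_mul, abs_mul, abs_of_pos hr0, abs_of_nonneg hξ0]
    _ ≤ r * (1 * |c * (a - b) - g|) + r * (ε / (2 * r * M) * M) := by gcongr
    _ < r * (1 * (ε / (2 * r))) + r * (ε / (2 * r * M) * M) := by gcongr
    _ = ε := by field_simp; norm_num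


/-- deterministic analogue of the limit of the test process
`D_{r,n}(u) = √n [(Cₙ(u^{1/r}))^r − Cₙ(u)]` under the hypothesis `H_{0,r}`. -/
theorem stmt5 (d : ℕ) (hd : 1 ≤ d) (r : ℝ) (hr : 1 ≤ r)
    (h : ℕ → (Fin d → ℝ) → ℝ) (h₀ : (Fin d → ℝ) → ℝ) (G : (Fin d → ℝ) → ℝ)
    (hrange : ∀ n, ∀ u : Fin d → ℝ, (∀ i, u i ∈ Set.Icc (0:ℝ) 1) →
        h n u ∈ Set.Icc (0:ℝ) 1)
    (hrange₀ : ∀ u : Fin d → ℝ, (∀ i, u i ∈ Set.Icc (0:ℝ) 1) →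
        h₀ u ∈ Set.Icc (0:ℝ) 1)
    (c : ℕ → ℝ) (hcpos : ∀ n, 0 < c n)
    (hc : Filter.Tendsto c Filter.atTop Filter.atTop)
    (hconv : ∀ ε > (0:ℝ), ∃ N : ℕ, ∀ n ≥ N, ∀ u : Fin d → ℝ,
        (∀ i, u i ∈ Set.Icc (0:ℝ) 1) → |c n * (h n u - h₀ u) - G u| < ε)
    (hms : ∀ u : Fin d → ℝ, (∀ i, u i ∈ Set.Icc (0:ℝ) 1) →
        h₀ u = (h₀ (fun i => u i ^ (1 / r))) ^ r) :
    ∀ ε > (0:ℝ), ∃ N : ℕ, ∀ n ≥ N, ∀ u : Fin d → ℝ,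
        (∀ i, u i ∈ Set.Icc (0:ℝ) 1) →
        |c n * ((h n (fun i => u i ^ (1 / r))) ^ r - h n u) -
          (r * (h₀ (fun i => u i ^ (1 / r))) ^ (r - 1) * G (fun i => u i ^ (1 / r))
            - G u)| < ε := by
  have hr0 : 0 < r := by linarith
  obtain ⟨N₀, hN₀⟩ := hconv 1 one_pos
  have hG : ∀ u : Fin d → ℝ, (∀ i, u i ∈ Set.Icc (0:ℝ) 1) → |G u| ≤ c N₀ + 1 := by
    intro u hu
    obtain ⟨h₁, h₂⟩ := abs_lt.1 (hN₀ N₀ le_rfl u hu)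
    obtain ⟨h₃, h₄⟩ := hrange N₀ u hu
    obtain ⟨h₅, h₆⟩ := hrange₀ u hu
    have := hcpos N₀
    rw [abs_le]
    constructor <;> nlinarith
  intro ε hε
  obtain ⟨C, η, hη, hdelta⟩ := exists_forall_abs_mul_rpow_sub_rpow_sub_lt hr
    (add_pos (hcpos N₀) one_pos) (half_pos hε)
  obtain ⟨N₁, hN₁⟩ := Filter.eventually_atTop.1 (hc.eventually_ge_atTop C)
  obtain ⟨N₂, hN₂⟩ := hconv η hη
  obtain ⟨N₃, hN₃⟩ := hconv (ε / 2) (half_pos hε)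
  refine ⟨max N₁ (max N₂ N₃), fun n hn u hu => ?_⟩
  simp only [ge_iff_le, max_le_iff] at hn
  obtain ⟨hn₁, hn₂, hn₃⟩ := hn
  have hv : ∀ i, (fun i => u i ^ (1 / r)) i ∈ Set.Icc (0:ℝ) 1 := fun i =>
    ⟨Real.rpow_nonneg (hu i).1 _, Real.rpow_le_one (hu i).1 (hu i).2 (by positivity)⟩
  have hu₀ := hms u hu
  set v : Fin d → ℝ := fun i => u i ^ (1 / r)
  have h₁ := hdelta (c n) (h n v) (h₀ v) (G v) (hcpos n) (hN₁ n hn₁) (hrange n v hv)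
    (hrange₀ v hv) (hG v hv) (hN₂ n hn₂ v hv)
  have h₂ := hN₃ n hn₃ u hu
  have hsplit : c n * (h n v ^ r - h n u) - (r * h₀ v ^ (r - 1) * G v - G u) =
      (c n * (h n v ^ r - h₀ v ^ r) - r * h₀ v ^ (r - 1) * G v) -
        (c n * (h n u - h₀ u) - G u) := by
    rw [hu₀]; ring
  rw [hsplit]
  exact (abs_sub _ _).trans_lt (by linarith)
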